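/- Let q, p ∈ ℕ ∪ {∞} with q, p ≥ 2. A continuous function f : 𝔻 × 𝔻 → ℂ which is positive definite on Ω_{2q} × Ω_{2p}, written in its (unique) expansion f(ξ,η) = Σ_{m,n,k,l∈ℤ₊} a_{m,n,k,l} R_{m,n}^{q−2}(ξ) R_{k,l}^{p−2}(η) with all a_{m,n,k,l} ≥ 0 and Σ a_{m,n,k,l} < ∞, is strictly positive definite on Ω_{2q} × Ω_{2p} if, and only if, the set J' = {(m−n, k−l) ∈ ℤ² : a_{m,n,k,l} > 0} intersects every product of full arithmetic progressions in ℤ, i.e. J' ∩ (Nℤ+x) × (Mℤ+y) ≠ ∅ for every N, M, x, y ∈ ℕ, N, M, x, y ≥ 1. -/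

import Mathlib

open scoped ComplexOrder

noncomputable section

/-- The Hilbert space ℓ²(ℂ) of square–summable complex sequences. -/
abbrev Ell2 : Type := lp (fun _ : ℕ => ℂ) 2

/-- The Hermitian inner product of the paper: `hdot z w = z·w = Σ_j z_j conj(w_j)`. -/
def hdot (z w : Ell2) : ℂ := @inner ℂ _ _ w z

/-- The sphere `Ω_{2q}` (for `q : ℕ∞`), viewed inside ℓ²(ℂ): the unit vectors supported
on the first `q` coordinates; for `q = ⊤` this is the unit sphere `Ω_∞` of ℓ²(ℂ). -/
def Omega (q : ℕ∞) : Set Ell2 :=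
  {z | ‖z‖ = 1 ∧ ∀ j : ℕ, q ≤ (j : ℕ∞) → z j = 0}

/-- A kernel `K` is positive definite on a set `S`. -/
def IsPDKernel {α : Type*} (S : Set α) (K : α → α → ℂ) : Prop :=
  ∀ (L : ℕ) (x : Fin L → α), (∀ i, x i ∈ S) → Function.Injective x →
    ∀ c : Fin L → ℂ, 0 ≤ ∑ μ, ∑ ν, c μ * (starRingEnd ℂ) (c ν) * K (x μ) (x ν)

/-- A kernel `K` is strictly positive definite on a set `S`. -/
def IsSPDKernel {α : Type*} (S : Set α) (K : α → α → ℂ) : Prop :=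
  IsPDKernel S K ∧
    ∀ (L : ℕ) (x : Fin L → α), (∀ i, x i ∈ S) → Function.Injective x →
      ∀ c : Fin L → ℂ,
        ∑ μ, ∑ ν, c μ * (starRingEnd ℂ) (c ν) * K (x μ) (x ν) = 0 → c = 0

/-- `f` is positive definite on `Ω_{2q} × Ω_{2p}`. -/
def PDonProd (q p : ℕ∞) (f : ℂ → ℂ → ℂ) : Prop :=
  IsPDKernel ((Omega q) ×ˢ (Omega p))
    (fun x y => f (hdot x.1 y.1) (hdot x.2 y.2))

/-- `f` is strictly positive definite on `Ω_{2q} × Ω_{2p}`. -/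
def SPDonProd (q p : ℕ∞) (f : ℂ → ℂ → ℂ) : Prop :=
  IsSPDKernel ((Omega q) ×ˢ (Omega p))
    (fun x y => f (hdot x.1 y.1) (hdot x.2 y.2))

/-- `g` is positive definite on `Ω_{2q}`. -/
def PDonSphere (q : ℕ∞) (g : ℂ → ℂ) : Prop :=
  IsPDKernel (Omega q) (fun z z' => g (hdot z z'))

/-- The Jacobi polynomial of degree `k` with (integer) parameters `α, β`, normalized
so that its value at `1` is `1`. -/
def jacobiR (α β k : ℕ) (x : ℝ) : ℝ :=
  (∑ s ∈ Finset.range (k + 1),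
      ((k + α).choose (k - s) : ℝ) * ((k + β).choose s : ℝ) *
        ((x - 1) / 2) ^ s * ((x + 1) / 2) ^ (k - s)) /
    ((k + α).choose k : ℝ)

/-- The disc polynomial `R_{m,n}^{q-2}`; for `q = ⊤` (and also `q = 1`) it is
`ξ^m conj(ξ)^n`.  For `2 ≤ q < ⊤` it equals
`r^{|m-n|} e^{i(m-n)φ} R_{min(m,n)}^{(q-2,|m-n|)}(2r²-1)` for `ξ = r e^{iφ}`. -/
def discR (q : ℕ∞) (m n : ℕ) (ξ : ℂ) : ℂ :=
  if q = ⊤ ∨ q ≤ 1 then ξ ^ m * (starRingEnd ℂ ξ) ^ n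
  else (if n ≤ m then ξ ^ (m - n) else (starRingEnd ℂ ξ) ^ (n - m)) *
    ((jacobiR (q.toNat - 2) (max m n - min m n) (min m n)
        (2 * ‖ξ‖ ^ 2 - 1) : ℝ) : ℂ)

/-- The natural domain `𝔻̃`: the unit circle `∂𝔻` when `q = 1` (the sphere `Ω₂`),
the closed unit disc `𝔻` otherwise. -/
def domD (q : ℕ∞) : Set ℂ :=
  if q = 1 then Metric.sphere (0 : ℂ) 1 else Metric.closedBall (0 : ℂ) 1

/-- `A ⊆ ℤ²` intersects every product of full arithmetic progressions in ℤ. -/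
def MeetsAllProgressions (A : Set (ℤ × ℤ)) : Prop :=
  ∀ N M x y : ℤ, 0 < N → 0 < M → 0 < x → 0 < y →
    ∃ v ∈ A, (∃ j : ℤ, v.1 = N * j + x) ∧ (∃ j : ℤ, v.2 = M * j + y)

/-- Orthogonality of the characters `θ ↦ e^{inθ}`. -/
lemma integral_exp_mul_I_zpow (n : ℤ) :
    ∫ θ in (0 : ℝ)..2 * Real.pi, Complex.exp (θ * Complex.I) ^ n =
      if n = 0 then (2 * Real.pi : ℂ) else 0 := by
  split_ifs with h
  · simp [h]
  · have h1 : ∀ θ : ℝ, Complex.exp (θ * Complex.I) ^ n =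
        Complex.exp ((n * Complex.I) * θ) := fun θ => by
      rw [← Complex.exp_int_mul]; congr 1; ring
    simp_rw [h1]
    rw [integral_exp_mul_complex (by simp [h])]
    have h2 : (n * Complex.I) * ((2 * Real.pi : ℝ) : ℂ) = n * (2 * Real.pi * Complex.I) := by
      push_cast; ring
    rw [h2, Complex.exp_int_mul_two_pi_mul_I]
    simp

lemma integral_add_exp_pow_mul_pow (r A B : ℂ) (m n : ℕ) (hnm : n ≤ m) :
    ∫ θ in (0 : ℝ)..2 * Real.pi, (r + A * Complex.exp (θ * Complex.I)) ^ m *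
        (r + B * (Complex.exp (θ * Complex.I))⁻¹) ^ n =
      2 * Real.pi * ∑ j ∈ Finset.range (n + 1),
        (m.choose j : ℂ) * (n.choose j : ℂ) * (A * B) ^ j * (r ^ (m - j) * r ^ (n - j)) := by
  have h1 : ∀ θ : ℝ, (r + A * Complex.exp (θ * Complex.I)) ^ m *
        (r + B * (Complex.exp (θ * Complex.I))⁻¹) ^ n =
      ∑ j ∈ Finset.range (n + 1), ∑ i ∈ Finset.range (m + 1),
        (A ^ i * r ^ (m - i) * m.choose i * (B ^ j * r ^ (n - j) * n.choose j)) *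
          Complex.exp (θ * Complex.I) ^ ((i : ℤ) - j) := fun θ => by
    rw [add_comm r, add_comm r, add_pow, add_pow, Finset.sum_mul_sum, Finset.sum_comm]
    refine Finset.sum_congr rfl fun j _ => Finset.sum_congr rfl fun i _ => ?_
    rw [zpow_sub₀ (Complex.exp_ne_zero _), zpow_natCast, zpow_natCast, mul_pow, mul_pow,
      inv_pow, div_eq_mul_inv]
    ring
  have hc : ∀ k : ℤ, Continuous fun θ : ℝ => Complex.exp (θ * Complex.I) ^ k := fun k =>
    (by fun_prop : Continuous fun θ : ℝ => Complex.exp (θ * Complex.I)).zpow₀ k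
      (fun θ => Or.inl (Complex.exp_ne_zero _))
  simp_rw [h1]
  rw [intervalIntegral.integral_finsetSum, Finset.mul_sum]
  swap
  · exact fun j _ => Continuous.intervalIntegrable
      (continuous_finsetSum _ fun i _ => continuous_const.mul (hc _)) _ _
  refine Finset.sum_congr rfl fun j hj => ?_
  rw [intervalIntegral.integral_finsetSum]
  swap
  · exact fun i _ => Continuous.intervalIntegrable (continuous_const.mul (hc _)) _ _
  simp_rw [intervalIntegral.integral_const_mul, integral_exp_mul_I_zpow, sub_eq_zero,
    Nat.cast_inj]
  have hj' : j ∈ Finset.range (m + 1) := by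
    simp only [Finset.mem_range] at hj ⊢; omega
  simp only [mul_ite, mul_zero, Finset.sum_ite_eq', hj', if_true, mul_pow]
  ring

lemma pow_mul_jacobiR_zero_eq_integral (β k : ℕ) (r : ℝ) (A B : ℂ) (hAB : A * B = r ^ 2 - 1) :
    ((2 * Real.pi * (r ^ β * jacobiR 0 β k (2 * r ^ 2 - 1)) : ℝ) : ℂ) =
      ∫ θ in (0 : ℝ)..2 * Real.pi, (r + A * Complex.exp (θ * Complex.I)) ^ (k + β) *
        (r + B * (Complex.exp (θ * Complex.I))⁻¹) ^ k := by
  rw [integral_add_exp_pow_mul_pow _ _ _ _ _ (Nat.le_add_right _ _), hAB, jacobiR]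
  push_cast
  rw [add_zero, Nat.choose_self, Nat.cast_one, div_one, Finset.mul_sum]
  congr 1
  refine Finset.sum_congr rfl fun j hj => ?_
  have hj : j ≤ k := by simp only [Finset.mem_range] at hj; omega
  rw [Nat.choose_symm hj, show k + β - j = β + (k - j) by omega, pow_add]
  rw [show ((2 : ℂ) * r ^ 2 - 1 - 1) / 2 = r ^ 2 - 1 by ring,
    show ((2 : ℂ) * r ^ 2 - 1 + 1) / 2 = r ^ 2 by ring]
  ring

/-- Weighted arithmetic–geometric inequality with a quadratic gain. -/
lemma pow_mul_pow_le_exp_neg (m n : ℕ) (x y : ℝ) (hx : 0 ≤ x) (hy : 0 ≤ y)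
    (h : m * x ^ 2 + n * y ^ 2 ≤ m + n) :
    x ^ m * y ^ n ≤ Real.exp (-(m * (x - 1) ^ 2 / 2)) := by
  have h1 : x ≤ Real.exp ((x ^ 2 - 1) / 2 - (x - 1) ^ 2 / 2) := by
    have := Real.add_one_le_exp (x - 1)
    rw [show (x ^ 2 - 1) / 2 - (x - 1) ^ 2 / 2 = x - 1 by ring]; linarith
  have h2 : y ≤ Real.exp ((y ^ 2 - 1) / 2) := by
    have := Real.add_one_le_exp (y - 1)
    refine le_trans (by linarith) (this.trans (Real.exp_le_exp.2 ?_))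
    nlinarith [sq_nonneg (y - 1)]
  calc x ^ m * y ^ n ≤ Real.exp ((x ^ 2 - 1) / 2 - (x - 1) ^ 2 / 2) ^ m *
        Real.exp ((y ^ 2 - 1) / 2) ^ n := by gcongr
    _ = Real.exp ((m * x ^ 2 + n * y ^ 2 - m - n) / 2 - m * (x - 1) ^ 2 / 2) := by
      rw [← Real.exp_nat_mul, ← Real.exp_nat_mul, ← Real.exp_add]; congr 1; ring
    _ ≤ _ := Real.exp_le_exp.2 (by linarith)

lemma normSq_add_mul_expMulI (r c θ : ℝ) :
    ‖(r : ℂ) + c * Complex.exp (θ * Complex.I)‖ ^ 2 = r ^ 2 + c ^ 2 + 2 * r * c * Real.cos θ := by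
  rw [← Complex.normSq_eq_norm_sq, Complex.normSq_apply]
  simp only [Complex.add_re, Complex.add_im, Complex.ofReal_re, Complex.ofReal_im,
    Complex.re_ofReal_mul, Complex.im_ofReal_mul, Complex.exp_ofReal_mul_I_re,
    Complex.exp_ofReal_mul_I_im]
  linear_combination c ^ 2 * Real.sin_sq_add_cos_sq θ

/-- The dominating integral for the disc polynomials with `α = 0`. -/
def discBound (r : ℝ) (m : ℕ) (t : ℝ) : ℝ :=
  ∫ θ in (0 : ℝ)..2 * Real.pi,
    Real.exp (-(m * (‖(r : ℂ) + (t * √(1 - r ^ 2) : ℝ) * Complex.exp (θ * Complex.I)‖ - 1) ^ 2 / 2))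

lemma abs_pow_mul_jacobiR_zero_le_discBound (β k : ℕ) (hk : k ≠ 0) (r : ℝ) (hr0 : 0 ≤ r)
    (hr1 : r ≤ 1) :
    2 * Real.pi * |r ^ β * jacobiR 0 β k (2 * r ^ 2 - 1)| ≤
      discBound r (k + β) (√(k / (k + β : ℕ))) := by
  set t := √((k : ℝ) / (k + β : ℕ)) with ht
  set s := √(1 - r ^ 2) with hs
  have hk0 : (0 : ℝ) < k := by positivity
  have hm0 : (0 : ℝ) < (k + β : ℕ) := by positivity
  have ht2 : t ^ 2 = k / (k + β : ℕ) := Real.sq_sqrt (by positivity)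
  have ht0 : 0 < t := Real.sqrt_pos.2 (by positivity)
  have hs2 : s ^ 2 = 1 - r ^ 2 := Real.sq_sqrt (by nlinarith)
  have hI := pow_mul_jacobiR_zero_eq_integral β k r ((t * s : ℝ) : ℂ) ((-(s / t) : ℝ) : ℂ) (by
    rw [← Complex.ofReal_mul, ← Complex.ofReal_pow, ← Complex.ofReal_one, ← Complex.ofReal_sub]
    congr 1; field_simp; linarith)
  have hL : 2 * Real.pi * |r ^ β * jacobiR 0 β k (2 * r ^ 2 - 1)| =
      ‖((2 * Real.pi * (r ^ β * jacobiR 0 β k (2 * r ^ 2 - 1)) : ℝ) : ℂ)‖ := by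
    rw [Complex.norm_real, Real.norm_eq_abs, abs_mul (2 * Real.pi), abs_of_pos Real.two_pi_pos]
  rw [hL, hI, discBound]
  refine intervalIntegral.norm_integral_le_of_norm_le Real.two_pi_pos.le
    (Filter.Eventually.of_forall fun θ _ => ?_) (Continuous.intervalIntegrable (by fun_prop) _ _)
  rw [norm_mul, norm_pow, norm_pow]
  refine pow_mul_pow_le_exp_neg _ _ _ _ (norm_nonneg _) (norm_nonneg _) (le_of_eq ?_)
  have hinv : (Complex.exp (θ * Complex.I))⁻¹ = Complex.exp ((-θ : ℝ) * Complex.I) := by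
    rw [← Complex.exp_neg]; congr 1; push_cast; ring
  rw [hinv, normSq_add_mul_expMulI, normSq_add_mul_expMulI, Real.cos_neg]
  have e1 : (k + β : ℕ) * (t * s) ^ 2 = k * s ^ 2 := by
    rw [mul_pow, ht2]; field_simp
  have e2 : k * (-(s / t)) ^ 2 = (k + β : ℕ) * s ^ 2 := by
    rw [neg_sq, div_pow, ht2]; field_simp
  have e3 : k * (-(s / t)) = -((k + β : ℕ) * (t * s)) := by
    have : (k : ℝ) = (k + β : ℕ) * t ^ 2 := by rw [ht2]; field_simp
    rw [this]; field_simp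
  linear_combination e1 + e2 + 2 * r * Real.cos θ * e3 + (k + (k + β : ℕ)) * hs2

lemma discBound_le (r : ℝ) (m : ℕ) (t : ℝ) : discBound r m t ≤ 2 * Real.pi := by
  have : ∫ _ in (0 : ℝ)..2 * Real.pi, (1 : ℝ) = 2 * Real.pi := by simp
  rw [← this, discBound]
  refine intervalIntegral.integral_mono_on Real.two_pi_pos.le
    (Continuous.intervalIntegrable (by fun_prop) _ _) (by simp) fun θ _ => ?_
  rw [Real.exp_le_one_iff]
  have : 0 ≤ (m : ℝ) * (‖(r : ℂ) + (t * √(1 - r ^ 2) : ℝ) *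
    Complex.exp (θ * Complex.I)‖ - 1) ^ 2 / 2 := by positivity
  linarith

lemma discBound_nonneg (r : ℝ) (m : ℕ) (t : ℝ) : 0 ≤ discBound r m t :=
  intervalIntegral.integral_nonneg Real.two_pi_pos.le fun _ _ => (Real.exp_pos _).le

lemma discBound_antitone (r t : ℝ) : Antitone fun m => discBound r m t := by
  intro m m' h
  refine intervalIntegral.integral_mono_on Real.two_pi_pos.le
    (Continuous.intervalIntegrable (by fun_prop) _ _)
    (Continuous.intervalIntegrable (by fun_prop) _ _) fun θ _ => ?_
  gcongr

lemma continuous_discBound (r : ℝ) (m : ℕ) : Continuous (discBound r m) := by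
  unfold discBound
  refine intervalIntegral.continuous_parametric_intervalIntegral_of_continuous' ?_ _ _
  unfold Function.uncurry
  fun_prop

lemma countable_cos_eq (c : ℝ) : {θ : ℝ | Real.cos θ = c}.Countable := by
  rcases Set.eq_empty_or_nonempty {θ : ℝ | Real.cos θ = c} with h | ⟨y, hy⟩
  · simp [h]
  · refine Set.Countable.mono (s₂ := Set.range (fun k : ℤ => 2 * k * Real.pi + y) ∪
      Set.range (fun k : ℤ => 2 * k * Real.pi - y)) ?_
      ((Set.countable_range _).union (Set.countable_range _))
    intro x hx
    have : Real.cos y = Real.cos x := by rw [hx.out, hy.out]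
    obtain ⟨k, hk | hk⟩ := (Real.cos_eq_cos_iff).1 this
    · exact Or.inl ⟨k, hk.symm⟩
    · exact Or.inr ⟨k, hk.symm⟩

lemma tendsto_discBound (r : ℝ) (hr0 : 0 < r) (hr1 : r < 1) (t : ℝ) :
    Filter.Tendsto (fun m => discBound r m t) Filter.atTop (nhds 0) := by
  have hs : 0 < √(1 - r ^ 2) := Real.sqrt_pos.2 (by nlinarith)
  have h0 : ∫ _ in (0 : ℝ)..2 * Real.pi, (0 : ℝ) = 0 := by simp
  rw [← h0]
  refine intervalIntegral.tendsto_integral_filter_of_dominated_convergence (fun _ => (1 : ℝ))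
    (Filter.Eventually.of_forall fun m => Continuous.aestronglyMeasurable (by fun_prop))
    (Filter.Eventually.of_forall fun m => Filter.Eventually.of_forall fun θ _ => ?_) (by simp) ?_
  · rw [Real.norm_eq_abs, Real.abs_exp, Real.exp_le_one_iff]
    have : 0 ≤ (m : ℝ) * (‖(r : ℂ) + (t * √(1 - r ^ 2) : ℝ) *
      Complex.exp (θ * Complex.I)‖ - 1) ^ 2 / 2 := by positivity
    linarith
  · have hne : ∀ᵐ θ : ℝ ∂MeasureTheory.volume, Real.cos θ ≠
        (1 - r ^ 2 - (t * √(1 - r ^ 2)) ^ 2) / (2 * r * (t * √(1 - r ^ 2))) := by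
      have := (countable_cos_eq ((1 - r ^ 2 - (t * √(1 - r ^ 2)) ^ 2) /
        (2 * r * (t * √(1 - r ^ 2))))).ae_notMem MeasureTheory.volume
      filter_upwards [this] with θ hθ
      exact hθ
    filter_upwards [hne] with θ hθ _
    have hn1 : ‖(r : ℂ) + (t * √(1 - r ^ 2) : ℝ) * Complex.exp (θ * Complex.I)‖ ≠ 1 := by
      intro h
      have h2 := normSq_add_mul_expMulI r (t * √(1 - r ^ 2)) θ
      rw [h] at h2
      by_cases ht : t = 0
      · subst ht; nlinarith
      · apply hθ
        field_simp
        linarith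
    have hpos : 0 < (‖(r : ℂ) + (t * √(1 - r ^ 2) : ℝ) *
        Complex.exp (θ * Complex.I)‖ - 1) ^ 2 / 2 := by
      have := sub_ne_zero.2 hn1
      positivity
    refine Real.tendsto_exp_neg_atTop_nhds_zero.comp ?_
    simp_rw [mul_div_assoc]
    exact tendsto_natCast_atTop_atTop.atTop_mul_const hpos

/-- `|R_{m,n}^0| ≤ 1` on the disc, in terms of Jacobi polynomials. -/
lemma abs_pow_mul_jacobiR_zero_le_one (β k : ℕ) (r : ℝ) (hr0 : 0 ≤ r) (hr1 : r ≤ 1) :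
    |r ^ β * jacobiR 0 β k (2 * r ^ 2 - 1)| ≤ 1 := by
  rcases Nat.eq_zero_or_pos k with rfl | hk
  · simpa [jacobiR, abs_of_nonneg hr0] using pow_le_one₀ hr0 hr1
  · have := (abs_pow_mul_jacobiR_zero_le_discBound β k hk.ne' r hr0 hr1).trans (discBound_le _ _ _)
    have hpi := Real.two_pi_pos
    by_contra! hc
    nlinarith

/-- Decay of `R_{m,n}^0(r)`, `r < 1`, as `|m - n| → ∞`. -/
lemma exists_abs_pow_mul_jacobiR_zero_le (r : ℝ) (hr0 : 0 ≤ r) (hr1 : r < 1) (ε : ℝ) (hε : 0 < ε) :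
    ∃ D : ℕ, ∀ β ≥ D, ∀ k, |r ^ β * jacobiR 0 β k (2 * r ^ 2 - 1)| ≤ ε := by
  rcases hr0.eq_or_lt with rfl | hr0
  · refine ⟨1, fun β hβ k => ?_⟩
    rw [zero_pow (by omega)]; simpa using hε.le
  have hdini : TendstoUniformlyOn (discBound r) 0 Filter.atTop (Set.Icc 0 1) :=
    Antitone.tendstoUniformlyOn_of_forall_tendsto isCompact_Icc
      (fun m => (continuous_discBound r m).continuousOn) (fun t _ => discBound_antitone r t)
      continuousOn_const (fun t _ => tendsto_discBound r hr0 hr1 t)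
  rw [Metric.tendstoUniformlyOn_iff] at hdini
  obtain ⟨D₁, hD₁⟩ := Filter.eventually_atTop.1 (hdini (2 * Real.pi * ε) (by positivity))
  obtain ⟨D₂, hD₂⟩ := Filter.eventually_atTop.1
    ((tendsto_pow_atTop_nhds_zero_of_lt_one hr0.le hr1).eventually (gt_mem_nhds hε))
  refine ⟨max D₁ D₂, fun β hβ k => ?_⟩
  rcases Nat.eq_zero_or_pos k with rfl | hk
  · simpa [jacobiR, abs_of_pos hr0] using (hD₂ β (le_of_max_le_right hβ)).le
  · have h1 := abs_pow_mul_jacobiR_zero_le_discBound β k hk.ne' r hr0.le hr1.le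
    have h2 := hD₁ (k + β) (by omega) (√(k / (k + β : ℕ))) ⟨Real.sqrt_nonneg _, by
      refine Real.sqrt_le_iff.2 ⟨zero_le_one, ?_⟩
      rw [one_pow]
      exact div_le_one_of_le₀ (by push_cast; linarith [Nat.cast_nonneg (α := ℝ) β])
        (Nat.cast_nonneg _)⟩
    rw [Pi.zero_apply, dist_zero_left, Real.norm_eq_abs, abs_of_nonneg (discBound_nonneg _ _ _)] at h2
    exact le_of_mul_le_mul_left (h1.trans h2.le) Real.two_pi_pos

/-- The Jacobi polynomial `P_k^{(α,β)}` in the variables `u = (x - 1) / 2`, `v = (x + 1) / 2`. -/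
def jacobiP (α β k : ℕ) (u v : ℝ) : ℝ :=
  ∑ s ∈ Finset.range (k + 1), ((k + α).choose (k - s) : ℝ) * ((k + β).choose s : ℝ) *
    u ^ s * v ^ (k - s)

lemma jacobiP_one_zero (α β k : ℕ) : jacobiP α β k 0 1 = (k + α).choose k := by
  rw [jacobiP, Finset.sum_eq_single 0]
  · simp
  · intro s _ hs; simp [hs]
  · simp

lemma choose_mul_sub_eq (a j : ℕ) :
    ((a : ℝ) - j) * a.choose j = (j + 1) * a.choose (j + 1) := by
  rcases le_total j a with h | h
  · have := Nat.choose_succ_right_eq a j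
    have h2 : ((a.choose (j + 1) * (j + 1) : ℕ) : ℝ) = (a.choose j * (a - j) : ℕ) := by rw [this]
    push_cast [Nat.cast_sub h] at h2
    linarith
  · rw [Nat.choose_eq_zero_of_lt (by omega : a < j + 1)]
    rcases h.eq_or_lt with rfl | h
    · simp
    · simp [Nat.choose_eq_zero_of_lt h]

lemma choose_mul_succ_sub_eq (b s : ℕ) (h : s ≤ b + 1) :
    ((b : ℝ) + 1) * b.choose s = (b + 1 - s) * (b + 1).choose s := by
  have := Nat.choose_mul_succ_eq b s
  have h2 : ((b.choose s * (b + 1) : ℕ) : ℝ) = ((b + 1).choose s * (b + 1 - s) : ℕ) := by rw [this]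
  push_cast [Nat.cast_sub h] at h2
  linarith

lemma choose_mul_succ_eq_succ (b s : ℕ) :
    ((b : ℝ) + 1) * b.choose s = (s + 1) * (b + 1).choose (s + 1) := by
  have := Nat.add_one_mul_choose_eq b s
  have h2 : (((b + 1) * b.choose s : ℕ) : ℝ) = ((b + 1).choose (s + 1) * (s + 1) : ℕ) := by rw [this]
  push_cast at h2
  linarith

/-- The contiguous relation expressing `P^{(α+1,β)}` through `P^{(α,β)}` with positive
coefficients. -/
lemma jacobiP_succ (α β k : ℕ) (u v : ℝ) (h : v = u + 1) :
    ((k : ℝ) + α + β + 2) * jacobiP (α + 1) β (k + 1) u v =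
      (k + 1 + β) * jacobiP (α + 1) β k u v +
        (2 * k + α + β + 3) * jacobiP α β (k + 1) u v := by
  have hone : jacobiP (α + 1) β k u v = v * jacobiP (α + 1) β k u v -
      u * jacobiP (α + 1) β k u v := by rw [h]; ring
  have hv : v * jacobiP (α + 1) β k u v = ∑ s ∈ Finset.range (k + 2),
      if s = k + 1 then 0 else ((k + 1 + α).choose (k - s) : ℝ) * ((k + β).choose s : ℝ) *
        u ^ s * v ^ (k + 1 - s) := by
    rw [Finset.sum_range_succ _ (k + 1), if_pos rfl, add_zero, jacobiP, Finset.mul_sum]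
    refine Finset.sum_congr rfl fun s hs => ?_
    rw [Finset.mem_range] at hs
    rw [if_neg (by omega), show k + 1 - s = (k - s) + 1 by omega, pow_succ,
      show k + (α + 1) = k + 1 + α by ring]
    ring
  have hu : u * jacobiP (α + 1) β k u v = ∑ s ∈ Finset.range (k + 2),
      if s = 0 then 0 else ((k + 1 + α).choose (k + 1 - s) : ℝ) * ((k + β).choose (s - 1) : ℝ) *
        u ^ s * v ^ (k + 1 - s) := by
    rw [Finset.sum_range_succ' _ (k + 1), if_pos rfl, add_zero, jacobiP, Finset.mul_sum]
    refine Finset.sum_congr rfl fun s hs => ?_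
    rw [if_neg (by omega), show k + 1 - (s + 1) = k - s by omega, pow_succ,
      show k + (α + 1) = k + 1 + α by ring, Nat.add_sub_cancel]
    ring
  rw [hone, hv, hu, jacobiP, jacobiP, ← Finset.sum_sub_distrib, Finset.mul_sum, Finset.mul_sum,
    Finset.mul_sum, ← Finset.sum_add_distrib]
  refine Finset.sum_congr rfl fun s hs => ?_
  rw [Finset.mem_range] at hs
  obtain ⟨j, hj⟩ : ∃ j, k + 1 = s + j := ⟨k + 1 - s, by omega⟩
  have hjs : k + 1 - s = j := by omega
  have hjr : (k : ℝ) + 1 = s + j := by exact_mod_cast hj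
  rw [hjs, show k + 1 + (α + 1) = (k + 1 + α) + 1 by ring,
    show k + 1 + β = (k + β) + 1 by ring]
  have f1 := choose_mul_succ_sub_eq (k + β) s (by omega)
  push_cast at f1
  have f2 : ((k : ℝ) + β + 1) * (if s = 0 then 0 else ((k + β).choose (s - 1) : ℝ)) =
      s * (k + β + 1).choose s := by
    rcases s with _ | s
    · simp
    · have := choose_mul_succ_eq_succ (k + β) s
      push_cast at this
      simpa using this
  have f3 : ((k + 1 + α + 1).choose j : ℝ) = (if s = k + 1 then 0 else
      ((k + 1 + α).choose (k - s) : ℝ)) + (k + 1 + α).choose j := by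
    rcases j with _ | j
    · simp [show s = k + 1 by omega]
    · rw [if_neg (by omega), show k - s = j by omega, Nat.choose_succ_succ]
      push_cast; ring
  have f4 : ((k : ℝ) + 2 + α - j) * (if s = k + 1 then 0 else
      ((k + 1 + α).choose (k - s) : ℝ)) = j * (k + 1 + α).choose j := by
    rcases j with _ | j
    · simp [show s = k + 1 by omega]
    · rw [if_neg (by omega), show k - s = j by omega]
      have := choose_mul_sub_eq (k + 1 + α) j
      push_cast at this ⊢
      linarith
  rw [f3]
  have g1 : (if s = k + 1 then 0 else ((k + 1 + α).choose (k - s) : ℝ) * ((k + β).choose s : ℝ) *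
        u ^ s * v ^ j) = (if s = k + 1 then 0 else ((k + 1 + α).choose (k - s) : ℝ)) *
        ((k + β).choose s : ℝ) * u ^ s * v ^ j := by
    split_ifs <;> ring
  have g2 : (if s = 0 then 0 else ((k + 1 + α).choose j : ℝ) * ((k + β).choose (s - 1) : ℝ) *
        u ^ s * v ^ j) = ((k + 1 + α).choose j : ℝ) * (if s = 0 then 0 else
        ((k + β).choose (s - 1) : ℝ)) * u ^ s * v ^ j := by
    split_ifs <;> ring
  rw [g1, g2]
  generalize (if s = k + 1 then 0 else ((k + 1 + α).choose (k - s) : ℝ)) = X at *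
  generalize (if s = 0 then 0 else ((k + β).choose (s - 1) : ℝ)) = Y at *
  generalize ((k + 1 + α).choose j : ℝ) = Z at *
  generalize ((k + β + 1).choose s : ℝ) = W at *
  generalize ((k + β).choose s : ℝ) = V at *
  linear_combination (-(u ^ s * v ^ j)) * (X * f1 - Z * f2 - W * f4) -
    W * u ^ s * v ^ j * (X + Z) * hjr

lemma jacobiR_eq (α β k : ℕ) (r : ℝ) :
    jacobiR α β k (2 * r ^ 2 - 1) = jacobiP α β k (r ^ 2 - 1) (r ^ 2) / (k + α).choose k := by
  rw [jacobiR, jacobiP, show (2 * r ^ 2 - 1 - 1) / 2 = r ^ 2 - 1 by ring,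
    show (2 * r ^ 2 - 1 + 1) / 2 = r ^ 2 by ring]

lemma jacobiR_one (α β k : ℕ) : jacobiR α β k 1 = 1 := by
  have h := jacobiR_eq α β k 1
  norm_num at h
  rw [h, jacobiP_one_zero, div_self]
  exact_mod_cast (Nat.choose_pos (Nat.le_add_right _ _)).ne'

/-- A bound uniform in the degree passes from the parameter `0` to every `α`. -/
lemma abs_pow_mul_jacobiR_le_of_zero (β : ℕ) (r M : ℝ)
    (h : ∀ k, |r ^ β * jacobiR 0 β k (2 * r ^ 2 - 1)| ≤ M) (α k : ℕ) :
    |r ^ β * jacobiR α β k (2 * r ^ 2 - 1)| ≤ M := by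
  induction α generalizing k with
  | zero => exact h k
  | succ α ih =>
    have key : ∀ α k, |r ^ β * jacobiR α β k (2 * r ^ 2 - 1)| ≤ M ↔
        |r ^ β * jacobiP α β k (r ^ 2 - 1) (r ^ 2)| ≤ M * (k + α).choose k := fun α k => by
      have hc : (0 : ℝ) < (k + α).choose k := by
        exact_mod_cast Nat.choose_pos (Nat.le_add_right _ _)
      rw [jacobiR_eq, ← mul_div_assoc, abs_div, abs_of_pos hc, div_le_iff₀ hc]
    simp only [key] at ih ⊢
    induction k with
    | zero => simpa [jacobiP] using ih 0
    | succ k ihk =>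
      have e := jacobiP_succ α β k (r ^ 2 - 1) (r ^ 2) (by ring)
      have e1 := jacobiP_succ α β k 0 1 (by ring)
      simp only [jacobiP_one_zero] at e1
      have hp : (0 : ℝ) < (k : ℝ) + α + β + 2 := by positivity
      refine le_of_mul_le_mul_left ?_ hp
      calc ((k : ℝ) + α + β + 2) * |r ^ β * jacobiP (α + 1) β (k + 1) (r ^ 2 - 1) (r ^ 2)|
          = |r ^ β * (((k : ℝ) + α + β + 2) *
              jacobiP (α + 1) β (k + 1) (r ^ 2 - 1) (r ^ 2))| := by
            rw [mul_left_comm, abs_mul ((k : ℝ) + α + β + 2), abs_of_pos hp]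
        _ = |(k + 1 + β) * (r ^ β * jacobiP (α + 1) β k (r ^ 2 - 1) (r ^ 2)) +
              (2 * k + α + β + 3) * (r ^ β * jacobiP α β (k + 1) (r ^ 2 - 1) (r ^ 2))| := by
            rw [e]; congr 1; ring
        _ ≤ (k + 1 + β) * |r ^ β * jacobiP (α + 1) β k (r ^ 2 - 1) (r ^ 2)| +
              (2 * k + α + β + 3) * |r ^ β * jacobiP α β (k + 1) (r ^ 2 - 1) (r ^ 2)| := by
            refine (abs_add_le _ _).trans (le_of_eq ?_)
            rw [abs_mul, abs_mul _ (r ^ β * _),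
              abs_of_pos (by positivity : (0 : ℝ) < k + 1 + β),
              abs_of_pos (by positivity : (0 : ℝ) < 2 * k + α + β + 3)]
        _ ≤ (k + 1 + β) * (M * (k + (α + 1)).choose k) +
              (2 * k + α + β + 3) * (M * (k + 1 + α).choose (k + 1)) := by
            gcongr
            exact ih _
        _ = _ := by linear_combination (-M) * e1

lemma abs_pow_mul_jacobiR_le_one (α β k : ℕ) (r : ℝ) (hr0 : 0 ≤ r) (hr1 : r ≤ 1) :
    |r ^ β * jacobiR α β k (2 * r ^ 2 - 1)| ≤ 1 :=
  abs_pow_mul_jacobiR_le_of_zero β r 1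
    (fun k => abs_pow_mul_jacobiR_zero_le_one β k r hr0 hr1) α k

lemma norm_discR_of_finite (q : ℕ∞) (hq : ¬(q = ⊤ ∨ q ≤ 1)) (m n : ℕ) (ξ : ℂ) :
    ‖discR q m n ξ‖ = |‖ξ‖ ^ (max m n - min m n) *
      jacobiR (q.toNat - 2) (max m n - min m n) (min m n) (2 * ‖ξ‖ ^ 2 - 1)| := by
  rw [discR, if_neg hq, norm_mul, Complex.norm_real, Real.norm_eq_abs, abs_mul]
  congr 1
  rw [abs_of_nonneg (by positivity)]
  split_ifs with h
  · rw [norm_pow, max_eq_left h, min_eq_right h]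
  · rw [norm_pow, Complex.norm_conj, max_eq_right (by omega), min_eq_left (by omega)]

/-- The disc polynomials are bounded by `1` on the disc. -/
lemma norm_discR_le_one (q : ℕ∞) (m n : ℕ) (ξ : ℂ) (hξ : ‖ξ‖ ≤ 1) : ‖discR q m n ξ‖ ≤ 1 := by
  by_cases hq : q = ⊤ ∨ q ≤ 1
  · rw [discR, if_pos hq, norm_mul, norm_pow, norm_pow, Complex.norm_conj]
    exact mul_le_one₀ (pow_le_one₀ (norm_nonneg _) hξ) (by positivity)
      (pow_le_one₀ (norm_nonneg _) hξ)
  · rw [norm_discR_of_finite q hq]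
    exact abs_pow_mul_jacobiR_le_one _ _ _ _ (norm_nonneg _) hξ

/-- The disc polynomials `R_{m,n}` tend to `0` inside the disc as `|m - n| → ∞`. -/
lemma exists_norm_discR_le (q : ℕ∞) (ξ : ℂ) (hξ : ‖ξ‖ < 1) (ε : ℝ) (hε : 0 < ε) :
    ∃ D : ℕ, ∀ m n : ℕ, (D : ℤ) ≤ |(m : ℤ) - n| → ‖discR q m n ξ‖ ≤ ε := by
  by_cases hq : q = ⊤ ∨ q ≤ 1
  · obtain ⟨D, hD⟩ := Filter.eventually_atTop.1
      ((tendsto_pow_atTop_nhds_zero_of_lt_one (norm_nonneg ξ) hξ).eventually (gt_mem_nhds hε))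
    refine ⟨D, fun m n h => ?_⟩
    rw [discR, if_pos hq, norm_mul, norm_pow, norm_pow, Complex.norm_conj, ← pow_add]
    refine (hD (m + n) ?_).le
    rcases abs_cases ((m : ℤ) - n) with h' | h' <;> omega
  · obtain ⟨D, hD⟩ := exists_abs_pow_mul_jacobiR_zero_le ‖ξ‖ (norm_nonneg _) hξ ε hε
    refine ⟨D, fun m n h => ?_⟩
    rw [norm_discR_of_finite q hq]
    refine abs_pow_mul_jacobiR_le_of_zero _ _ _ (hD _ ?_) _ _
    rcases abs_cases ((m : ℤ) - n) with h' | h' <;> omega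

lemma discR_one (q : ℕ∞) (m n : ℕ) : discR q m n 1 = 1 := by
  unfold discR
  split_ifs <;> norm_num [jacobiR_one]

/-- `R_{m,n}(uξ) = u^{m-n} R_{m,n}(ξ)` for unimodular `u`. -/
lemma discR_unit_mul (q : ℕ∞) (m n : ℕ) (u ξ : ℂ) (hu : ‖u‖ = 1) :
    discR q m n (u * ξ) = u ^ ((m : ℤ) - n) * discR q m n ξ := by
  have hu0 : u ≠ 0 := norm_ne_zero_iff.1 (by simp [hu])
  have hc : (starRingEnd ℂ) u = u⁻¹ := by
    rw [Complex.inv_def, Complex.normSq_eq_norm_sq, hu]; simp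
  rw [discR, discR, map_mul, hc, norm_mul, hu, one_mul]
  split_ifs with h1 h2
  · rw [mul_pow, mul_pow, zpow_sub₀ hu0, zpow_natCast, zpow_natCast, inv_pow]
    ring
  · rw [mul_pow, ← Nat.cast_sub h2, zpow_natCast, mul_assoc]
  · rw [mul_pow, ← neg_sub (n : ℤ), zpow_neg, ← Nat.cast_sub (by omega : m ≤ n), zpow_natCast,
      inv_pow, mul_assoc]

lemma isJacobsonRing_int : IsJacobsonRing ℤ := by
  rw [isJacobsonRing_iff_prime_eq]
  intro P hP
  by_cases h : P = ⊥
  · subst h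
    refine le_antisymm (fun x hx => ?_) Ideal.le_jacobson
    rw [Ideal.mem_jacobson_bot] at hx
    have := Int.isUnit_iff.1 (hx x)
    rw [Ideal.mem_bot]
    rcases this with h | h <;> nlinarith
  · have : P.IsMaximal := hP.isMaximal h
    exact Ideal.jacobson_eq_self_of_isMaximal

lemma finite_of_field_of_finite_int (K : Type*) [Field K] [Module.Finite ℤ K] : Finite K := by
  refine Module.finite_of_fg_torsion K ?_
  have hni : ¬ Function.Injective (algebraMap ℤ K) := fun hinj => by
    have hf := isField_of_isIntegral_of_isField hinj (Field.toIsField K)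
    have hu := hf.mul_inv_cancel (a := (2 : ℤ)) (by norm_num)
    obtain ⟨b, hb⟩ := hu
    omega
  rw [injective_iff_map_eq_zero] at hni
  push Not at hni
  obtain ⟨n, hn, hn0⟩ := hni
  intro x
  refine ⟨⟨n, mem_nonZeroDivisors_of_ne_zero hn0⟩, ?_⟩
  change n • x = 0
  rw [Algebra.smul_def, hn, zero_mul]

/-- A nonzero element of a finitely generated domain survives in some finite residue field. -/
lemma exists_maximal_finite_quotient {R : Type*} [CommRing R] [IsDomain R]
    [Algebra.FiniteType ℤ R] (x : R) (hx : x ≠ 0) :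
    ∃ I : Ideal R, I.IsMaximal ∧ Finite (R ⧸ I) ∧ x ∉ I := by
  have := isJacobsonRing_int
  have hR : IsJacobsonRing R := isJacobsonRing_of_finiteType (A := ℤ)
  have hbot : (⊥ : Ideal R).jacobson = ⊥ := hR.out Ideal.isPrime_bot.isRadical
  have hx' : x ∉ (⊥ : Ideal R).jacobson := by rwa [hbot]
  rw [Ideal.jacobson, Ideal.mem_sInf] at hx'
  push Not at hx'
  obtain ⟨I, ⟨-, hI⟩, hxI⟩ := hx'
  refine ⟨I, hI, ?_, hxI⟩
  let _ : Field (R ⧸ I) := Ideal.Quotient.field I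
  have hfin : Module.Finite ℤ (R ⧸ I) := finite_of_finite_type_of_isJacobsonRing ℤ (R ⧸ I)
  exact finite_of_field_of_finite_int (R ⧸ I)

/-- An exponential sum on `ℤ²` that is nonzero at a point is nonzero on a whole coset of a
finite index subgroup containing that point. -/
lemma exists_coset_exp_sum_ne_zero {ι : Type*} (s : Finset ι) (c : ι → ℂ) (u v : ι → ℂˣ)
    (d₀ e₀ : ℤ) (h : ∑ i ∈ s, c i * (u i : ℂ) ^ d₀ * (v i : ℂ) ^ e₀ ≠ 0) :
    ∃ N : ℕ, 0 < N ∧ ∀ j k : ℤ,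
      ∑ i ∈ s, c i * (u i : ℂ) ^ (d₀ + N * j) * (v i : ℂ) ^ (e₀ + N * k) ≠ 0 := by
  classical
  let T : Finset ℂ := s.image c ∪ s.image (fun i => (u i : ℂ)) ∪ s.image (fun i => ((u i)⁻¹ : ℂ)) ∪
    s.image (fun i => (v i : ℂ)) ∪ s.image (fun i => ((v i)⁻¹ : ℂ))
  let R := Algebra.adjoin ℤ (T : Set ℂ)
  have hfg : Algebra.FiniteType ℤ R := .adjoin_of_finite T.finite_toSet
  have hT : ∀ z ∈ T, z ∈ R := fun z hz => Algebra.subset_adjoin hz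
  have hc : ∀ i ∈ s, c i ∈ R := fun i hi => hT _ (by
    simp only [T, Finset.mem_union]; simp only [Finset.mem_image_of_mem c hi, true_or])
  have hu : ∀ i ∈ s, (u i : ℂ) ∈ R := fun i hi => hT _ (by
    simp only [T, Finset.mem_union]
    simp only [Finset.mem_image_of_mem (fun i => (u i : ℂ)) hi, true_or, or_true])
  have hui : ∀ i ∈ s, ((u i)⁻¹ : ℂ) ∈ R := fun i hi => hT _ (by
    simp only [T, Finset.mem_union]
    simp only [Finset.mem_image_of_mem (fun i => ((u i)⁻¹ : ℂ)) hi, true_or, or_true])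
  have hv : ∀ i ∈ s, (v i : ℂ) ∈ R := fun i hi => hT _ (by
    simp only [T, Finset.mem_union]
    simp only [Finset.mem_image_of_mem (fun i => (v i : ℂ)) hi, true_or, or_true])
  have hvi : ∀ i ∈ s, ((v i)⁻¹ : ℂ) ∈ R := fun i hi => hT _ (by
    simp only [T, Finset.mem_union]
    simp only [Finset.mem_image_of_mem (fun i => ((v i)⁻¹ : ℂ)) hi, or_true])
  let c' : s → R := fun i => ⟨c i, hc i i.2⟩
  let u' : s → Rˣ := fun i => ⟨⟨u i, hu i i.2⟩, ⟨(u i)⁻¹, hui i i.2⟩,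
    Subtype.ext (by simp), Subtype.ext (by simp)⟩
  let v' : s → Rˣ := fun i => ⟨⟨v i, hv i i.2⟩, ⟨(v i)⁻¹, hvi i i.2⟩,
    Subtype.ext (by simp), Subtype.ext (by simp)⟩
  let P : ℤ → ℤ → R := fun d e => ∑ i, c' i * ((u' i ^ d : Rˣ) : R) * ((v' i ^ e : Rˣ) : R)
  have hval : ∀ w : Rˣ, ∀ d : ℤ, (((w ^ d : Rˣ) : R) : ℂ) = ((w : R) : ℂ) ^ d := fun w d => by
    have := (Units.map (R.val : R →* ℂ)).map_zpow w d
    have h2 := congrArg (Units.val) this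
    rw [Units.val_zpow_eq_zpow_val] at h2
    exact h2
  have hP : ∀ d e, (P d e : ℂ) = ∑ i ∈ s, c i * (u i : ℂ) ^ d * (v i : ℂ) ^ e := fun d e => by
    rw [← Finset.sum_coe_sort s]
    simp only [P, AddSubmonoidClass.coe_finsetSum, MulMemClass.coe_mul, hval]
    rfl
  obtain ⟨I, hI, hfin, hPI⟩ := exists_maximal_finite_quotient (P d₀ e₀) (fun h0 => h (by
    rw [← hP, h0]; rfl))
  let π := Ideal.Quotient.mk I
  have : Finite (R ⧸ I)ˣ := inferInstance
  refine ⟨Nat.card (R ⧸ I)ˣ, Nat.card_pos, fun j k h0 => hPI ?_⟩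
  have hpow : ∀ w : Rˣ, ∀ d j : ℤ, π ((w ^ (d + (Nat.card (R ⧸ I)ˣ : ℤ) * j) : Rˣ) : R) =
      π ((w ^ d : Rˣ) : R) := fun w d j => by
    have e : Units.map (π : R →* R ⧸ I) (w ^ (d + (Nat.card (R ⧸ I)ˣ : ℤ) * j)) =
        Units.map (π : R →* R ⧸ I) (w ^ d) := by
      rw [map_zpow, map_zpow, zpow_add, zpow_mul, zpow_natCast, pow_card_eq_one', one_zpow, mul_one]
    exact congrArg Units.val e
  have hz : P (d₀ + (Nat.card (R ⧸ I)ˣ : ℤ) * j) (e₀ + (Nat.card (R ⧸ I)ˣ : ℤ) * k) = 0 :=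
    Subtype.ext (by rw [hP]; exact h0)
  rw [← Ideal.Quotient.eq_zero_iff_mem]
  change π _ = 0
  have := congrArg π hz
  simp only [P, map_sum, map_mul, hpow, map_zero] at this ⊢
  exact this

/-- Distinct characters of `ℤ²` are linearly independent. -/
lemma exists_exp_sum_ne_zero {ι : Type*} (s : Finset ι) (c : ι → ℂ) (u v : ι → ℂˣ)
    (hinj : ∀ i ∈ s, ∀ j ∈ s, u i = u j → v i = v j → i = j) (i₀ : ι) (hi₀ : i₀ ∈ s)
    (hc : c i₀ ≠ 0) :
    ∃ d e : ℤ, ∑ i ∈ s, c i * (u i : ℂ) ^ d * (v i : ℂ) ^ e ≠ 0 := by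
  by_contra! h
  let χ : s → (Multiplicative ℤ × Multiplicative ℤ →* ℂ) := fun i =>
    (Units.coeHom ℂ).comp (MonoidHom.coprod (zpowersHom ℂˣ (u i)) (zpowersHom ℂˣ (v i)))
  have hχ : ∀ (i : s) (d e : ℤ), χ i (Multiplicative.ofAdd d, Multiplicative.ofAdd e) =
      (u i : ℂ) ^ d * (v i : ℂ) ^ e := fun i d e => by
    simp [χ, zpowersHom_apply]
  have hχinj : Function.Injective χ := fun i j hij => by
    have h1 := hχ i 1 0
    have h2 := hχ i 0 1
    rw [hij, hχ] at h1 h2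
    simp only [zpow_one, zpow_zero, mul_one, one_mul] at h1 h2
    exact Subtype.ext (hinj i i.2 j j.2 (Units.ext h1.symm) (Units.ext h2.symm))
  have hli := (linearIndependent_monoidHom (Multiplicative ℤ × Multiplicative ℤ) ℂ).comp χ hχinj
  rw [Fintype.linearIndependent_iff] at hli
  refine hc (hli (fun i => c i) ?_ ⟨i₀, hi₀⟩)
  funext g
  have := h g.1.toAdd g.2.toAdd
  rw [← Finset.sum_coe_sort s] at this
  simp only [Finset.sum_apply, Pi.smul_apply, Function.comp, smul_eq_mul, Pi.zero_apply]
  rw [← this]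
  refine Finset.sum_congr rfl fun i _ => ?_
  rw [mul_assoc, ← hχ]
  rfl

/-- A positive definite kernel gives nonnegative quadratic forms over finite sets. -/
lemma IsPDKernel.sum_finset_nonneg {α : Type*} {S : Set α} {K : α → α → ℂ} (hK : IsPDKernel S K)
    (s : Finset α) (hs : ∀ a ∈ s, a ∈ S) (c : α → ℂ) :
    0 ≤ ∑ a ∈ s, ∑ b ∈ s, c a * (starRingEnd ℂ) (c b) * K a b := by
  have h := hK s.card (fun i => (s.equivFin.symm i : α)) (fun i => hs _ (s.equivFin.symm i).2)
    (Subtype.val_injective.comp s.equivFin.symm.injective) (fun i => c (s.equivFin.symm i))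
  rw [← Finset.sum_coe_sort s]
  simp_rw [← Finset.sum_coe_sort s (fun b => _ * (starRingEnd ℂ) (c b) * K _ b)]
  rw [← s.equivFin.symm.sum_comp]
  simp_rw [← s.equivFin.symm.sum_comp (fun b : s => _ * (starRingEnd ℂ) (c b) * K _ b)]
  exact h

lemma eq_zero_of_forall_quadratic_nonneg (A B k : ℂ)
    (h : ∀ τ : ℂ, 0 ≤ (starRingEnd ℂ) τ * A + τ * B + τ * (starRingEnd ℂ) τ * k) : A = 0 := by
  have key : ∀ C : ℂ, (∀ t : ℝ, 0 ≤ (t : ℂ) * C + (t : ℂ) ^ 2 * k) → C = 0 := fun C hC => by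
    have hre : ∀ t : ℝ, 0 ≤ t * C.re + t ^ 2 * k.re ∧ 0 = t * C.im + t ^ 2 * k.im := fun t => by
      have := Complex.le_def.1 (hC t)
      rw [← Complex.ofReal_pow] at this
      simpa only [Complex.zero_re, Complex.zero_im, Complex.add_re, Complex.add_im,
        Complex.re_ofReal_mul, Complex.im_ofReal_mul] using this
    have him1 := (hre 1).2
    have him2 := (hre (-1)).2
    have him : C.im = 0 := by linarith
    have hr : C.re = 0 := by
      by_contra hne
      have hsq : 0 < C.re ^ 2 := by positivity
      have h1 := (hre (-C.re / (|k.re| + 1))).1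
      have hk : 0 < |k.re| + 1 := by positivity
      have h2 : -C.re / (|k.re| + 1) * C.re + (-C.re / (|k.re| + 1)) ^ 2 * k.re =
          C.re ^ 2 / (|k.re| + 1) ^ 2 * (k.re - (|k.re| + 1)) := by
        field_simp
        ring
      rw [h2] at h1
      have h3 : 0 < C.re ^ 2 / (|k.re| + 1) ^ 2 := by positivity
      nlinarith [le_abs_self k.re]
    exact Complex.ext hr him
  have h1 : A + B = 0 := key _ fun t => by
    have := h t
    rw [Complex.conj_ofReal] at this
    convert this using 1
    ring
  have h2 : Complex.I * (B - A) = 0 := key _ fun t => by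
    have := h (t * Complex.I)
    rw [map_mul, Complex.conj_ofReal, Complex.conj_I] at this
    convert this using 1
    linear_combination ((t : ℂ) ^ 2 * k) * Complex.I_sq
  have h3 : B - A = 0 := (mul_eq_zero.1 h2).resolve_left Complex.I_ne_zero
  linear_combination (h1 - h3) / 2

/-- A null vector of a positive definite kernel lies in its radical. -/
lemma IsPDKernel.sum_eq_zero {α : Type*} {S : Set α} {K : α → α → ℂ} (hK : IsPDKernel S K)
    (L : ℕ) (x : Fin L → α) (hx : ∀ i, x i ∈ S) (hinj : Function.Injective x) (c : Fin L → ℂ)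
    (h0 : ∑ μ, ∑ ν, c μ * (starRingEnd ℂ) (c ν) * K (x μ) (x ν) = 0) (y : α) (hy : y ∈ S) :
    ∑ μ, c μ * K (x μ) y = 0 := by
  classical
  let s : Finset α := insert y (Finset.univ.image x)
  have hs : ∀ a ∈ s, a ∈ S := fun a ha => by
    simp only [s, Finset.mem_insert, Finset.mem_image, Finset.mem_univ, true_and] at ha
    rcases ha with rfl | ⟨i, rfl⟩
    · exact hy
    · exact hx i
  let C : α → ℂ := Function.extend x c 0
  have hC : ∀ i, C (x i) = c i := fun i => hinj.extend_apply c 0 i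
  have hsum : ∀ F : α → ℂ, ∑ a ∈ s, C a * F a = ∑ μ, c μ * F (x μ) := fun F => by
    have h1 : ∑ a ∈ s, C a * F a = ∑ a ∈ Finset.univ.image x, C a * F a := by
      symm
      refine Finset.sum_subset (Finset.subset_insert _ _) fun a _ ha => ?_
      have : C a = 0 := by
        refine Function.extend_apply' c (0 : α → ℂ) a fun ⟨i, hi⟩ => ha ?_
        exact Finset.mem_image.2 ⟨i, Finset.mem_univ _, hi⟩
      rw [this, zero_mul]
    rw [h1, Finset.sum_image fun i _ j _ h => hinj h]
    simp_rw [hC]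
  have hsumc : ∀ F : α → ℂ, ∑ a ∈ s, (starRingEnd ℂ) (C a) * F a =
      ∑ μ, (starRingEnd ℂ) (c μ) * F (x μ) := fun F => by
    have := congrArg (starRingEnd ℂ) (hsum fun a => (starRingEnd ℂ) (F a))
    simpa [map_sum, map_mul] using this
  refine eq_zero_of_forall_quadratic_nonneg _ (∑ b ∈ s, (starRingEnd ℂ) (C b) * K y b) (K y y)
    fun τ => ?_
  have hq := hK.sum_finset_nonneg s hs (fun a => C a + τ * if a = y then 1 else 0)
  convert hq using 1
  have hys : y ∈ s := Finset.mem_insert_self _ _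
  have hQ : ∑ a ∈ s, ∑ b ∈ s, C a * (starRingEnd ℂ) (C b) * K a b = 0 := by
    rw [← h0]
    simp_rw [mul_assoc, ← Finset.mul_sum]
    rw [hsum]
    simp_rw [hsumc]
  have e : ∀ a b, (C a + τ * if a = y then 1 else 0) *
      (starRingEnd ℂ) (C b + τ * if b = y then 1 else 0) * K a b =
      C a * (starRingEnd ℂ) (C b) * K a b +
      (if b = y then (starRingEnd ℂ) τ * (C a * K a b) else 0) +
      (if a = y then τ * ((starRingEnd ℂ) (C b) * K a b) else 0) +
      (if a = y then if b = y then τ * (starRingEnd ℂ) τ * K a b else 0 else 0) := fun a b => by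
    split_ifs <;> simp <;> ring
  simp_rw [e, Finset.sum_add_distrib, hQ]
  simp only [Finset.sum_ite_eq', hys, if_true, Finset.sum_ite_irrel, Finset.sum_const_zero,
    ← Finset.mul_sum, hsum]
  ring

/-- Uniqueness of the coefficients of an absolutely convergent trigonometric series. -/
lemma tsum_ite_eq_zero_of_trig_series {ι : Type*} [Countable ι] (b : ι → ℂ)
    (hb : Summable fun i => ‖b i‖) (D : ι → ℤ)
    (h : ∀ u : ℂ, ‖u‖ = 1 → ∑' i, b i * u ^ D i = 0) (d : ℤ) :
    ∑' i, (if D i = d then b i else 0) = 0 := by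
  let F : ι → C(ℝ, ℂ) := fun i => ⟨fun θ => b i * Complex.exp (θ * Complex.I) ^ (D i - d),
    continuous_const.mul ((by fun_prop : Continuous fun θ : ℝ =>
      Complex.exp (θ * Complex.I)).zpow₀ _ (fun θ => Or.inl (Complex.exp_ne_zero _)))⟩
  have hnorm : ∀ i θ, ‖F i θ‖ = ‖b i‖ := fun i θ => by
    simp [F, norm_zpow, Complex.norm_exp_ofReal_mul_I]
  have hF := intervalIntegral.hasSum_intervalIntegral_of_summable_norm (f := F) (a := 0)
    (b := 2 * Real.pi) (hb.of_nonneg_of_le (fun i => norm_nonneg _) fun i =>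
      (ContinuousMap.norm_le _ (norm_nonneg _)).2 fun θ => (hnorm i θ).le)
  have hz : ∀ θ : ℝ, ∑' i, F i θ = 0 := fun θ => by
    have hu : ‖Complex.exp (θ * Complex.I)‖ = 1 := Complex.norm_exp_ofReal_mul_I θ
    have := h _ hu
    simp only [F, ContinuousMap.coe_mk]
    simp_rw [zpow_sub₀ (Complex.exp_ne_zero _), mul_div_assoc', div_eq_mul_inv]
    rw [tsum_mul_right, this, zero_mul]
  simp_rw [hz] at hF
  have hF2 := hF.tsum_eq
  have e : ∀ i, ∫ θ in (0 : ℝ)..2 * Real.pi, F i θ =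
      (2 * Real.pi : ℂ) * (if D i = d then b i else 0) := fun i => by
    simp only [F, ContinuousMap.coe_mk, intervalIntegral.integral_const_mul,
      integral_exp_mul_I_zpow, sub_eq_zero]
    split_ifs <;> ring
  simp_rw [e] at hF2
  rw [tsum_mul_left, intervalIntegral.integral_zero] at hF2
  exact (mul_eq_zero.1 hF2).resolve_left (by simp [Real.pi_ne_zero])

lemma hdot_smul_left (u : ℂ) (z w : Ell2) : hdot (u • z) w = u * hdot z w := by
  simp only [hdot, inner_smul_right]

lemma hdot_smul_right (u : ℂ) (z w : Ell2) : hdot z (u • w) = (starRingEnd ℂ) u * hdot z w := by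
  simp only [hdot, inner_smul_left]

lemma hdot_self_of_norm_one (z : Ell2) (hz : ‖z‖ = 1) : hdot z z = 1 := by
  rw [hdot, inner_self_eq_norm_sq_to_K, hz]; simp

lemma norm_hdot_le_one (z w : Ell2) (hz : ‖z‖ = 1) (hw : ‖w‖ = 1) : ‖hdot z w‖ ≤ 1 := by
  have := norm_inner_le_norm (𝕜 := ℂ) w z
  rwa [hz, hw, one_mul] at this

/-- The equality case of the Cauchy–Schwarz inequality on the unit sphere. -/
lemma eq_hdot_smul_of_norm_hdot_eq_one (z w : Ell2) (hz : ‖z‖ = 1) (hw : ‖w‖ = 1)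
    (h : ‖hdot z w‖ = 1) : z = hdot z w • w := by
  have hw0 : w ≠ 0 := norm_ne_zero_iff.1 (by simp [hw])
  have h1 : ‖@inner ℂ _ _ w z‖ = ‖w‖ * ‖z‖ := by rw [hw, hz, mul_one]; exact h
  have h2 := (norm_inner_eq_norm_iff hw0 (norm_ne_zero_iff.1 (by simp [hz]))).1 h1
  obtain ⟨r, -, hr⟩ := h2
  have : hdot z w = r := by
    rw [hr, hdot_smul_left, hdot_self_of_norm_one w hw, mul_one]
  rw [this]; exact hr

lemma smul_mem_Omega (q : ℕ∞) (u : ℂ) (hu : ‖u‖ = 1) (z : Ell2) (hz : z ∈ Omega q) :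
    u • z ∈ Omega q := by
  refine ⟨by rw [norm_smul, hu, hz.1, one_mul], fun j hj => ?_⟩
  rw [lp.coeFn_smul, Pi.smul_apply, hz.2 j hj, smul_zero]

/-- The series `Σ a_{m,n,k,l} R_{m,n}(ξ) R_{k,l}(η)`. -/
def discSeries (q p : ℕ∞) (a : ℕ × ℕ × ℕ × ℕ → ℝ) (ξ η : ℂ) : ℂ :=
  ∑' i : ℕ × ℕ × ℕ × ℕ, (a i : ℂ) * discR q i.1 i.2.1 ξ * discR p i.2.2.1 i.2.2.2 η

/-- The coefficients `a_{m,n,k,l}` with `m - n = d` and `k - l = e`. -/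
def coeffPart (a : ℕ × ℕ × ℕ × ℕ → ℝ) (d e : ℤ) (i : ℕ × ℕ × ℕ × ℕ) : ℝ :=
  if (i.1 : ℤ) - i.2.1 = d ∧ (i.2.2.1 : ℤ) - i.2.2.2 = e then a i else 0

lemma coeffPart_nonneg {a : ℕ × ℕ × ℕ × ℕ → ℝ} (ha0 : ∀ i, 0 ≤ a i) (d e : ℤ) (i) :
    0 ≤ coeffPart a d e i := by
  unfold coeffPart; split_ifs
  exacts [ha0 i, le_rfl]

lemma summable_coeffPart {a : ℕ × ℕ × ℕ × ℕ → ℝ} (ha0 : ∀ i, 0 ≤ a i) (haS : Summable a)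
    (d e : ℤ) : Summable (coeffPart a d e) :=
  haS.of_nonneg_of_le (coeffPart_nonneg ha0 d e) fun i => by
    unfold coeffPart; split_ifs
    exacts [le_rfl, ha0 i]

lemma norm_discSeries_term_le {q p : ℕ∞} {a : ℕ × ℕ × ℕ × ℕ → ℝ} (ha0 : ∀ i, 0 ≤ a i)
    {ξ η : ℂ} (hξ : ‖ξ‖ ≤ 1) (hη : ‖η‖ ≤ 1) (i : ℕ × ℕ × ℕ × ℕ) :
    ‖(a i : ℂ) * discR q i.1 i.2.1 ξ * discR p i.2.2.1 i.2.2.2 η‖ ≤ a i := by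
  rw [norm_mul, norm_mul, Complex.norm_real, Real.norm_of_nonneg (ha0 i), mul_assoc]
  exact mul_le_of_le_one_right (ha0 i) (mul_le_one₀ (norm_discR_le_one _ _ _ _ hξ)
    (norm_nonneg _) (norm_discR_le_one _ _ _ _ hη))

lemma summable_norm_discSeries {q p : ℕ∞} {a : ℕ × ℕ × ℕ × ℕ → ℝ} (ha0 : ∀ i, 0 ≤ a i)
    (haS : Summable a) {ξ η : ℂ} (hξ : ‖ξ‖ ≤ 1) (hη : ‖η‖ ≤ 1) :
    Summable fun i : ℕ × ℕ × ℕ × ℕ =>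
      ‖(a i : ℂ) * discR q i.1 i.2.1 ξ * discR p i.2.2.1 i.2.2.2 η‖ :=
  haS.of_nonneg_of_le (fun _ => norm_nonneg _) (norm_discSeries_term_le ha0 hξ hη)

lemma discSeries_one_one (q p : ℕ∞) (a : ℕ × ℕ × ℕ × ℕ → ℝ) :
    discSeries q p a 1 1 = ((∑' i, a i : ℝ) : ℂ) := by
  simp [discSeries, discR_one, Complex.ofReal_tsum]

lemma discSeries_coeffPart_unit_mul (q p : ℕ∞) (a : ℕ × ℕ × ℕ × ℕ → ℝ) (d e : ℤ) (u v ξ η : ℂ)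
    (hu : ‖u‖ = 1) (hv : ‖v‖ = 1) :
    discSeries q p (coeffPart a d e) (u * ξ) (v * η) =
      u ^ d * v ^ e * discSeries q p (coeffPart a d e) ξ η := by
  rw [discSeries, discSeries, ← tsum_mul_left]
  refine tsum_congr fun i => ?_
  rw [discR_unit_mul _ _ _ _ _ hu, discR_unit_mul _ _ _ _ _ hv, coeffPart]
  split_ifs with h
  · rw [h.1, h.2]; ring
  · simp

lemma exists_norm_discSeries_coeffPart_le (q p : ℕ∞) {a : ℕ × ℕ × ℕ × ℕ → ℝ}
    (ha0 : ∀ i, 0 ≤ a i) (haS : Summable a) {ξ η : ℂ} (hξ : ‖ξ‖ ≤ 1) (hη : ‖η‖ ≤ 1)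
    (h1 : ‖ξ‖ < 1 ∨ ‖η‖ < 1) (ε : ℝ) (hε : 0 < ε) :
    ∃ D : ℕ, ∀ d e : ℤ, (D : ℤ) ≤ |d| → (D : ℤ) ≤ |e| →
      ‖discSeries q p (coeffPart a d e) ξ η‖ ≤ ε * ∑' i, coeffPart a d e i := by
  obtain ⟨D, hD⟩ : ∃ D : ℕ, ∀ m n k l : ℕ, (D : ℤ) ≤ |(m : ℤ) - n| → (D : ℤ) ≤ |(k : ℤ) - l| →
      ‖discR q m n ξ‖ * ‖discR p k l η‖ ≤ ε := by
    rcases h1 with h1 | h1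
    · obtain ⟨D, hD⟩ := exists_norm_discR_le q ξ h1 ε hε
      exact ⟨D, fun m n k l h _ => (mul_le_of_le_one_right (norm_nonneg _)
        (norm_discR_le_one _ _ _ _ hη)).trans (hD m n h)⟩
    · obtain ⟨D, hD⟩ := exists_norm_discR_le p η h1 ε hε
      exact ⟨D, fun m n k l _ h => (mul_le_of_le_one_left (norm_nonneg _)
        (norm_discR_le_one _ _ _ _ hξ)).trans (hD k l h)⟩
  refine ⟨D, fun d e hd he => ?_⟩
  rw [← tsum_mul_left, discSeries]
  have hs := summable_norm_discSeries (q := q) (p := p) (coeffPart_nonneg ha0 d e)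
    (summable_coeffPart ha0 haS d e) hξ hη
  refine (norm_tsum_le_tsum_norm hs).trans (hs.tsum_le_tsum (fun i => ?_)
    ((summable_coeffPart ha0 haS d e).mul_left ε))
  rw [norm_mul, norm_mul, Complex.norm_real, Real.norm_of_nonneg (coeffPart_nonneg ha0 d e i),
    mul_assoc, mul_comm ε]
  unfold coeffPart
  split_ifs with h
  · exact mul_le_mul_of_nonneg_left (hD _ _ _ _ (h.1 ▸ hd) (h.2 ▸ he)) (ha0 i)
  · simp

/-- A null vector of the kernel is a null vector of each of its bihomogeneous parts. -/
lemma sum_mul_discSeries_coeffPart_eq_zero (q p : ℕ∞) {a : ℕ × ℕ × ℕ × ℕ → ℝ}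
    (ha0 : ∀ i, 0 ≤ a i) (haS : Summable a) {κ : Type*} [Fintype κ] (c ξ η : κ → ℂ)
    (hξ : ∀ μ, ‖ξ μ‖ ≤ 1) (hη : ∀ μ, ‖η μ‖ ≤ 1)
    (h : ∀ u v : ℂ, ‖u‖ = 1 → ‖v‖ = 1 →
      ∑ μ, c μ * discSeries q p a (u * ξ μ) (v * η μ) = 0) (d e : ℤ) :
    ∑ μ, c μ * discSeries q p (coeffPart a d e) (ξ μ) (η μ) = 0 := by
  let T : κ → ℕ × ℕ × ℕ × ℕ → ℂ := fun μ i =>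
    (a i : ℂ) * discR q i.1 i.2.1 (ξ μ) * discR p i.2.2.1 i.2.2.2 (η μ)
  let B : ℕ × ℕ × ℕ × ℕ → ℂ := fun i => ∑ μ, c μ * T μ i
  have hT : ∀ μ, Summable fun i => ‖T μ i‖ := fun μ =>
    summable_norm_discSeries ha0 haS (hξ μ) (hη μ)
  have hB : Summable fun i => ‖B i‖ := by
    refine Summable.of_nonneg_of_le (fun _ => norm_nonneg _)
      (fun i => norm_sum_le Finset.univ fun μ => c μ * T μ i) ?_
    refine summable_sum fun μ _ => ?_
    simp_rw [norm_mul]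
    exact (hT μ).mul_left _
  have h1 : ∀ u v : ℂ, ‖u‖ = 1 → ‖v‖ = 1 →
      ∑' i : ℕ × ℕ × ℕ × ℕ, B i * u ^ ((i.1 : ℤ) - i.2.1) * v ^ ((i.2.2.1 : ℤ) - i.2.2.2) = 0 :=
    fun u v hu hv => by
    rw [← h u v hu hv]
    simp_rw [discSeries, ← tsum_mul_left]
    rw [← Summable.tsum_finsetSum]
    · refine tsum_congr fun i => ?_
      rw [Finset.sum_mul, Finset.sum_mul]
      refine Finset.sum_congr rfl fun μ _ => ?_
      rw [discR_unit_mul _ _ _ _ _ hu, discR_unit_mul _ _ _ _ _ hv]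
      ring
    · intro μ _
      exact (summable_norm_discSeries ha0 haS (by rw [norm_mul, hu, one_mul]; exact hξ μ)
        (by rw [norm_mul, hv, one_mul]; exact hη μ)).of_norm.mul_left _
  have h2 : ∀ v : ℂ, ‖v‖ = 1 → ∑' i : ℕ × ℕ × ℕ × ℕ, (if (i.1 : ℤ) - i.2.1 = d then B i else 0) *
      v ^ ((i.2.2.1 : ℤ) - i.2.2.2) = 0 := fun v hv => by
    have := tsum_ite_eq_zero_of_trig_series
      (fun i : ℕ × ℕ × ℕ × ℕ => B i * v ^ ((i.2.2.1 : ℤ) - i.2.2.2))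
      (by simpa [norm_zpow, hv] using hB) (fun i => (i.1 : ℤ) - i.2.1)
      (fun u hu => by simpa only [mul_right_comm] using h1 u v hu hv) d
    simpa only [ite_mul, zero_mul] using this
  have h3 := tsum_ite_eq_zero_of_trig_series _
    (hB.of_nonneg_of_le (fun _ => norm_nonneg _) fun i => by
      split_ifs
      exacts [le_rfl, by simp]) (fun i : ℕ × ℕ × ℕ × ℕ => (i.2.2.1 : ℤ) - i.2.2.2) h2 e
  rw [← h3]
  simp_rw [discSeries, ← tsum_mul_left]
  rw [← Summable.tsum_finsetSum]
  · refine tsum_congr fun i => ?_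
    simp only [B, T, coeffPart]
    by_cases hd : (i.1 : ℤ) - i.2.1 = d <;> by_cases he : (i.2.2.1 : ℤ) - i.2.2.2 = e <;>
      simp [hd, he]
  · intro μ _
    exact (summable_norm_discSeries (coeffPart_nonneg ha0 d e) (summable_coeffPart ha0 haS d e)
      (hξ μ) (hη μ)).of_norm.mul_left _

lemma exists_progression_abs_ge (N : ℕ) (hN : 0 < N) (D : ℕ) (d₀ : ℤ) :
    ∃ N' x : ℤ, 0 < N' ∧ 0 < x ∧
      ∀ j : ℤ, (D : ℤ) ≤ |N' * j + x| ∧ ∃ i : ℤ, N' * j + x = d₀ + N * i := by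
  have hN1 : (1 : ℤ) ≤ N := by exact_mod_cast hN
  have hd := neg_abs_le d₀
  have hd' := abs_nonneg d₀
  have hx : (D : ℤ) + 1 ≤ d₀ + N * (|d₀| + D + 1) := by nlinarith
  obtain ⟨x, hxe⟩ : ∃ x, x = d₀ + N * (|d₀| + D + 1) := ⟨_, rfl⟩
  rw [← hxe] at hx
  have hN' : x + D ≤ N * (x + D) := by nlinarith
  refine ⟨N * (x + D), x, by omega, by omega, fun j => ⟨?_, ?_⟩⟩
  · rcases le_or_gt 0 j with hj | hj
    · exact le_trans (by nlinarith) (le_abs_self _)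
    · exact le_trans (by nlinarith) (neg_le_abs _)
  · exact ⟨(x + D) * j + (|d₀| + D + 1), by rw [hxe]; ring⟩

/-- For large `|d|` and `|e|` the bihomogeneous part of degree `(d, e)` is nondegenerate on
finitely many points that lie in distinct orbits of the torus. -/
lemma exists_forall_eq_zero_of_sum_mul_discSeries (q p : ℕ∞) {a : ℕ × ℕ × ℕ × ℕ → ℝ}
    (ha0 : ∀ i, 0 ≤ a i) (haS : Summable a) {κ : Type*} [Fintype κ] (z w : κ → Ell2)
    (hz : ∀ i, ‖z i‖ = 1) (hw : ∀ i, ‖w i‖ = 1)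
    (hzw : ∀ i j, i ≠ j → ‖hdot (z i) (z j)‖ < 1 ∨ ‖hdot (w i) (w j)‖ < 1) :
    ∃ D : ℕ, ∀ d e : ℤ, (D : ℤ) ≤ |d| → (D : ℤ) ≤ |e| → 0 < ∑' i, coeffPart a d e i →
      ∀ P : κ → ℂ, (∀ j, ∑ i, P i * discSeries q p (coeffPart a d e) (hdot (z i) (z j))
        (hdot (w i) (w j)) = 0) → P = 0 := by
  classical
  set ε : ℝ := 1 / (Fintype.card κ + 1) with hε
  have hε0 : 0 < ε := by positivity
  have key : ∀ t : κ × κ, ∃ D : ℕ, t.1 ≠ t.2 → ∀ d e : ℤ, (D : ℤ) ≤ |d| → (D : ℤ) ≤ |e| →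
      ‖discSeries q p (coeffPart a d e) (hdot (z t.1) (z t.2)) (hdot (w t.1) (w t.2))‖ ≤
        ε * ∑' i, coeffPart a d e i := fun t => by
    by_cases ht : t.1 = t.2
    · exact ⟨0, fun h => absurd ht h⟩
    · obtain ⟨D, hD⟩ := exists_norm_discSeries_coeffPart_le q p ha0 haS
        (norm_hdot_le_one _ _ (hz t.1) (hz t.2)) (norm_hdot_le_one _ _ (hw t.1) (hw t.2))
        (hzw _ _ ht) ε hε0
      exact ⟨D, fun _ => hD⟩
  choose D hD using key
  have hle : ∀ t, D t ≤ Finset.univ.sup D := fun t => Finset.le_sup (Finset.mem_univ t)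
  refine ⟨Finset.univ.sup D, fun d e hd he hA P hP => ?_⟩
  let M : Matrix κ κ ℂ := fun j i =>
    discSeries q p (coeffPart a d e) (hdot (z i) (z j)) (hdot (w i) (w j))
  have hdiag : ∀ k, ‖M k k‖ = ∑' i, coeffPart a d e i := fun k => by
    simp only [M]
    rw [hdot_self_of_norm_one _ (hz k), hdot_self_of_norm_one _ (hw k), discSeries_one_one,
      Complex.norm_real, Real.norm_of_nonneg hA.le]
  refine Matrix.eq_zero_of_mulVec_eq_zero (M := M) (det_ne_zero_of_sum_row_lt_diag fun k => ?_) ?_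
  · rw [hdiag]
    calc ∑ j ∈ Finset.univ.erase k, ‖M k j‖
        ≤ ∑ _j ∈ Finset.univ.erase k, ε * ∑' i, coeffPart a d e i :=
          Finset.sum_le_sum fun j hj => hD (j, k) (Finset.ne_of_mem_erase hj) d e
            (le_trans (by exact_mod_cast hle _) hd) (le_trans (by exact_mod_cast hle _) he)
      _ = ((Finset.univ.erase k).card * ε) * ∑' i, coeffPart a d e i := by
          rw [Finset.sum_const, nsmul_eq_mul, mul_assoc]
      _ < 1 * ∑' i, coeffPart a d e i := by
          refine mul_lt_mul_of_pos_right ?_ hA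
          have : ((Finset.univ.erase k).card : ℝ) ≤ Fintype.card κ := by
            exact_mod_cast Finset.card_le_univ _
          rw [hε, mul_one_div, div_lt_one (by positivity)]
          linarith
      _ = _ := one_mul _
  · ext j
    rw [Matrix.mulVec, dotProduct, Pi.zero_apply, ← hP j]
    exact Finset.sum_congr rfl fun i _ => mul_comm _ _

/-- If the index set of the expansion meets all products of arithmetic progressions, then no
nonzero vector is annihilated by all bihomogeneous parts of the kernel. -/
lemma eq_zero_of_forall_sum_mul_discSeries_coeffPart (q p : ℕ∞) {a : ℕ × ℕ × ℕ × ℕ → ℝ}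
    (ha0 : ∀ i, 0 ≤ a i) (haS : Summable a)
    (hJ : MeetsAllProgressions {v : ℤ × ℤ | ∃ m n k l : ℕ, 0 < a (m, n, k, l) ∧
      v = ((m : ℤ) - (n : ℤ), (k : ℤ) - (l : ℤ))})
    {κ : Type*} [Fintype κ] (z w : κ → Ell2) (hz : ∀ i, ‖z i‖ = 1) (hw : ∀ i, ‖w i‖ = 1)
    (hinj : ∀ i j, z i = z j → w i = w j → i = j) (c : κ → ℂ)
    (h : ∀ (d e : ℤ) (ν : κ), ∑ μ, c μ * discSeries q p (coeffPart a d e) (hdot (z μ) (z ν))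
      (hdot (w μ) (w ν)) = 0) : c = 0 := by
  classical
  let S : Setoid κ :=
    { r := fun μ ν => ∃ u v : ℂˣ, ‖(u : ℂ)‖ = 1 ∧ ‖(v : ℂ)‖ = 1 ∧ z μ = (u : ℂ) • z ν ∧
        w μ = (v : ℂ) • w ν
      iseqv :=
        { refl := fun μ => ⟨1, 1, by simp⟩
          symm := by
            rintro μ ν ⟨u, v, hu, hv, h1, h2⟩
            exact ⟨u⁻¹, v⁻¹, by simp [hu], by simp [hv], by rw [h1, smul_smul]; simp,
              by rw [h2, smul_smul]; simp⟩
          trans := by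
            rintro μ ν τ ⟨u, v, hu, hv, h1, h2⟩ ⟨u', v', hu', hv', h1', h2'⟩
            exact ⟨u * u', v * v', by simp [hu, hu'], by simp [hv, hv'],
              by rw [h1, h1', smul_smul, Units.val_mul],
              by rw [h2, h2', smul_smul, Units.val_mul]⟩ } }
  let cl : κ → Quotient S := fun μ => Quotient.mk S μ
  let rep : Quotient S → κ := Quotient.out
  have hcl : ∀ C, cl (rep C) = C := Quotient.out_eq
  have hrel : ∀ μ, ∃ u v : ℂˣ, ‖(u : ℂ)‖ = 1 ∧ ‖(v : ℂ)‖ = 1 ∧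
      z μ = (u : ℂ) • z (rep (cl μ)) ∧ w μ = (v : ℂ) • w (rep (cl μ)) := fun μ =>
    Quotient.exact (s := S) (hcl (cl μ)).symm
  choose u v hu hv hzu hwv using hrel
  have hsep : ∀ C C' : Quotient S, C ≠ C' → ‖hdot (z (rep C)) (z (rep C'))‖ < 1 ∨
      ‖hdot (w (rep C)) (w (rep C'))‖ < 1 := fun C C' hne => by
    by_contra! hcon
    have h1 := le_antisymm (norm_hdot_le_one _ _ (hz (rep C)) (hz (rep C'))) hcon.1
    have h2 := le_antisymm (norm_hdot_le_one _ _ (hw (rep C)) (hw (rep C'))) hcon.2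
    refine hne ?_
    rw [← hcl C, ← hcl C']
    refine Quotient.sound (s := S) ⟨Units.mk0 (hdot _ _) (norm_ne_zero_iff.1 (by rw [h1]; simp)),
      Units.mk0 (hdot _ _) (norm_ne_zero_iff.1 (by rw [h2]; simp)), h1, h2,
      eq_hdot_smul_of_norm_hdot_eq_one _ _ (hz _) (hz _) h1,
      eq_hdot_smul_of_norm_hdot_eq_one _ _ (hw _) (hw _) h2⟩
  obtain ⟨D, hD⟩ := exists_forall_eq_zero_of_sum_mul_discSeries q p ha0 haS
    (fun C => z (rep C)) (fun C => w (rep C)) (fun _ => hz _) (fun _ => hw _) hsep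
  by_contra hc
  obtain ⟨μ₀, hμ₀⟩ := Function.ne_iff.1 hc
  let s : Finset κ := Finset.univ.filter fun μ => cl μ = cl μ₀
  have hs : ∀ i ∈ s, cl i = cl μ₀ := fun i hi => (Finset.mem_filter.1 hi).2
  obtain ⟨d₀, e₀, hde⟩ := exists_exp_sum_ne_zero s c u v (fun i hi j hj h1 h2 => hinj i j
    (by rw [hzu i, hzu j, h1, hs i hi, hs j hj]) (by rw [hwv i, hwv j, h2, hs i hi, hs j hj]))
    μ₀ (by simp [s]) hμ₀
  obtain ⟨N, hN, hcoset⟩ := exists_coset_exp_sum_ne_zero s c u v d₀ e₀ hde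
  obtain ⟨N', x, hN', hx, hxj⟩ := exists_progression_abs_ge N hN D d₀
  obtain ⟨M', y, hM', hy, hyj⟩ := exists_progression_abs_ge N hN D e₀
  obtain ⟨_, ⟨m, n, k, l, hpos, rfl⟩, ⟨j, hj⟩, ⟨j', hj'⟩⟩ := hJ N' M' x y hN' hM' hx hy
  dsimp only at hj hj'
  obtain ⟨hd, i, hi⟩ := hxj j
  obtain ⟨he, i', hi'⟩ := hyj j'
  rw [← hj] at hd hi
  rw [← hj'] at he hi'
  generalize hdd : (m : ℤ) - n = d at *
  generalize hee : (k : ℤ) - l = e at *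
  have hA : 0 < ∑' i, coeffPart a d e i :=
    (summable_coeffPart ha0 haS d e).tsum_pos (coeffPart_nonneg ha0 d e) (m, n, k, l)
      (by simp only [coeffPart, hdd, hee, and_self, if_true]; exact hpos)
  have hP := hD d e hd he hA
    (fun C => ∑ μ ∈ Finset.univ.filter fun μ => cl μ = C, c μ * (u μ : ℂ) ^ d * (v μ : ℂ) ^ e)
    fun C₀ => by
      rw [← h d e (rep C₀), ← Finset.sum_fiberwise (s := Finset.univ) (g := cl)]
      refine Finset.sum_congr rfl fun C _ => ?_
      rw [Finset.sum_mul]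
      refine Finset.sum_congr rfl fun μ hμ => ?_
      rw [hzu μ, hwv μ, (Finset.mem_filter.1 hμ).2, hdot_smul_left, hdot_smul_left,
        discSeries_coeffPart_unit_mul _ _ _ _ _ _ _ _ _ (hu μ) (hv μ)]
      ring
  refine hcoset i i' ?_
  rw [← hi, ← hi']
  exact congrFun hP (cl μ₀)

lemma IsSPDKernel.eq_zero_of_forall_sum_eq_zero {α : Type*} {S : Set α} {K : α → α → ℂ}
    (hK : IsSPDKernel S K) {κ : Type*} [Fintype κ] (x : κ → α) (hx : ∀ i, x i ∈ S)
    (hinj : Function.Injective x) (c : κ → ℂ) (h : ∀ ν, ∑ μ, c μ * K (x μ) (x ν) = 0) :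
    c = 0 := by
  let φ := Fintype.equivFin κ
  have h0 := hK.2 (Fintype.card κ) (x ∘ φ.symm) (fun i => hx _) (hinj.comp φ.symm.injective)
    (c ∘ φ.symm) (by
      rw [Finset.sum_comm]
      refine Finset.sum_eq_zero fun ν _ => ?_
      have h1 := h (φ.symm ν)
      rw [← φ.symm.sum_comp] at h1
      rw [← mul_zero ((starRingEnd ℂ) ((c ∘ φ.symm) ν)), ← h1, Finset.mul_sum]
      refine Finset.sum_congr rfl fun μ _ => ?_
      simp only [Function.comp_apply]
      ring)
  funext i
  simpa using congrFun h0 (φ i)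

lemma IsPrimitiveRoot.sum_zpow_pow_eq_zero {N : ℕ} {ω : ℂ} (hω : IsPrimitiveRoot ω N) (t : ℤ)
    (ht : ¬(N : ℤ) ∣ t) : ∑ s : Fin N, (ω ^ (s : ℕ)) ^ t = 0 := by
  have hne : ω ^ t - 1 ≠ 0 := sub_ne_zero.2 fun h => ht ((hω.zpow_eq_one_iff_dvd t).1 h)
  have h1 : ∀ s : ℕ, (ω ^ s) ^ t = (ω ^ t) ^ s := fun s => by
    rw [← zpow_natCast, ← zpow_natCast, ← zpow_mul, ← zpow_mul, mul_comm]
  simp_rw [h1]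
  rw [Fin.sum_univ_eq_sum_range (fun s => (ω ^ t) ^ s) N]
  refine (mul_eq_zero.1 ?_).resolve_right hne
  rw [geom_sum_mul, ← h1, hω.pow_eq_one, one_zpow, sub_self]

lemma lp_single_zero_mem_Omega (q : ℕ∞) (hq : 2 ≤ q) : (lp.single 2 0 (1 : ℂ) : Ell2) ∈ Omega q := by
  refine ⟨by simp [lp.norm_single], fun j hj => ?_⟩
  have hj0 : j ≠ 0 := by
    rintro rfl
    exact absurd (hq.trans hj) (by simp)
  simp [lp.single_apply, hj0]

lemma sum_roots_mul_discSeries_eq_zero {q p : ℕ∞} {a : ℕ × ℕ × ℕ × ℕ → ℝ} (ha0 : ∀ i, 0 ≤ a i)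
    (haS : Summable a) {N M : ℕ} (hN : N ≠ 0) (hM : M ≠ 0) {ω τ : ℂ} (hω : IsPrimitiveRoot ω N)
    (hτ : IsPrimitiveRoot τ M) (x y : ℤ)
    (hxy : ∀ m n k l : ℕ, 0 < a (m, n, k, l) → (N : ℤ) ∣ (m : ℤ) - n - x →
      ¬(M : ℤ) ∣ (k : ℤ) - l - y) (α β : ℂ) (hα : ‖α‖ ≤ 1) (hβ : ‖β‖ ≤ 1) :
    ∑ t : Fin N × Fin M, (ω ^ (t.1 : ℕ)) ^ (-x) * (τ ^ (t.2 : ℕ)) ^ (-y) *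
      discSeries q p a (ω ^ (t.1 : ℕ) * α) (τ ^ (t.2 : ℕ) * β) = 0 := by
  have hω1 : ∀ s : ℕ, ‖ω ^ s‖ = 1 := fun s => by rw [norm_pow, hω.norm'_eq_one hN, one_pow]
  have hτ1 : ∀ s : ℕ, ‖τ ^ s‖ = 1 := fun s => by rw [norm_pow, hτ.norm'_eq_one hM, one_pow]
  have hω0 : ∀ s : ℕ, ω ^ s ≠ 0 := fun s => norm_ne_zero_iff.1 (by simp [hω1])
  have hτ0 : ∀ s : ℕ, τ ^ s ≠ 0 := fun s => norm_ne_zero_iff.1 (by simp [hτ1])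
  simp_rw [discSeries, ← tsum_mul_left]
  rw [← Summable.tsum_finsetSum fun t _ => (summable_norm_discSeries ha0 haS
    (by rw [norm_mul, hω1, one_mul]; exact hα)
    (by rw [norm_mul, hτ1, one_mul]; exact hβ)).of_norm.mul_left _, ← tsum_zero]
  refine tsum_congr fun i => ?_
  obtain ⟨m, n, k, l⟩ := i
  dsimp only
  rcases (ha0 (m, n, k, l)).eq_or_lt with h0 | h0
  · simp [← h0]
  have hprod : (∑ s : Fin N, (ω ^ (s : ℕ)) ^ ((m : ℤ) - n - x)) *
      ∑ s : Fin M, (τ ^ (s : ℕ)) ^ ((k : ℤ) - l - y) = 0 := by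
    by_cases hd : (N : ℤ) ∣ (m : ℤ) - n - x
    · rw [hτ.sum_zpow_pow_eq_zero _ (hxy m n k l h0 hd), mul_zero]
    · rw [hω.sum_zpow_pow_eq_zero _ hd, zero_mul]
  rw [Finset.sum_mul_sum, ← Finset.sum_product', Finset.univ_product_univ] at hprod
  rw [← mul_zero ((a (m, n, k, l) : ℂ) * discR q m n α * discR p k l β), ← hprod,
    Finset.mul_sum]
  refine Finset.sum_congr rfl fun t _ => ?_
  rw [discR_unit_mul _ _ _ _ _ (hω1 _), discR_unit_mul _ _ _ _ _ (hτ1 _),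
    sub_eq_add_neg _ x, sub_eq_add_neg _ y, zpow_add₀ (hω0 _), zpow_add₀ (hτ0 _)]
  ring

/-- Strict positive definiteness, tested on products of roots of unity, forces the index set of
the expansion to meet all products of arithmetic progressions. -/
lemma SPDonProd.meetsAllProgressions {q p : ℕ∞} (hq : 2 ≤ q) (hp : 2 ≤ p) {f : ℂ → ℂ → ℂ}
    {a : ℕ × ℕ × ℕ × ℕ → ℝ} (ha0 : ∀ i, 0 ≤ a i) (haS : Summable a)
    (hexp : ∀ ξ ∈ Metric.closedBall (0 : ℂ) 1, ∀ η ∈ Metric.closedBall (0 : ℂ) 1,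
      f ξ η = discSeries q p a ξ η) (hf : SPDonProd q p f) :
    MeetsAllProgressions {v : ℤ × ℤ | ∃ m n k l : ℕ, 0 < a (m, n, k, l) ∧
      v = ((m : ℤ) - (n : ℤ), (k : ℤ) - (l : ℤ))} := by
  intro N M x y hN hM _ _
  lift N to ℕ using hN.le
  lift M to ℕ using hM.le
  have hN0 : N ≠ 0 := by omega
  have hM0 : M ≠ 0 := by omega
  by_contra! hcon
  obtain ⟨ω, hω⟩ : ∃ ω : ℂ, IsPrimitiveRoot ω N := ⟨_, Complex.isPrimitiveRoot_exp N hN0⟩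
  obtain ⟨τ, hτ⟩ : ∃ τ : ℂ, IsPrimitiveRoot τ M := ⟨_, Complex.isPrimitiveRoot_exp M hM0⟩
  have hω1 : ∀ s : ℕ, ‖ω ^ s‖ = 1 := fun s => by rw [norm_pow, hω.norm'_eq_one hN0, one_pow]
  have hτ1 : ∀ s : ℕ, ‖τ ^ s‖ = 1 := fun s => by rw [norm_pow, hτ.norm'_eq_one hM0, one_pow]
  let e₀ : Ell2 := lp.single 2 0 (1 : ℂ)
  have he₀ : ∀ r : ℕ∞, 2 ≤ r → e₀ ∈ Omega r := lp_single_zero_mem_Omega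
  have hn : ‖e₀‖ = 1 := (he₀ q hq).1
  have hne : e₀ ≠ 0 := norm_ne_zero_iff.1 (by simp [hn])
  have hc := hf.eq_zero_of_forall_sum_eq_zero
    (fun t : Fin N × Fin M => (ω ^ (t.1 : ℕ) • e₀, τ ^ (t.2 : ℕ) • e₀))
    (fun t => ⟨smul_mem_Omega q _ (hω1 _) _ (he₀ q hq), smul_mem_Omega p _ (hτ1 _) _ (he₀ p hp)⟩)
    (fun t t' htt => by
      obtain ⟨h1, h2⟩ := Prod.ext_iff.1 htt
      have h1' := hω.pow_inj t.1.2 t'.1.2 (smul_left_injective ℂ hne h1)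
      have h2' := hτ.pow_inj t.2.2 t'.2.2 (smul_left_injective ℂ hne h2)
      exact Prod.ext (Fin.ext h1') (Fin.ext h2'))
    (fun t => (ω ^ (t.1 : ℕ)) ^ (-x) * (τ ^ (t.2 : ℕ)) ^ (-y)) fun t => by
      have hα : ‖(starRingEnd ℂ) (ω ^ (t.1 : ℕ))‖ = 1 := by rw [RCLike.norm_conj, hω1]
      have hβ : ‖(starRingEnd ℂ) (τ ^ (t.2 : ℕ))‖ = 1 := by rw [RCLike.norm_conj, hτ1]
      rw [← sum_roots_mul_discSeries_eq_zero (q := q) (p := p) ha0 haS hN0 hM0 hω hτ x y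
        (fun m n k l h0 ⟨j, hj⟩ ⟨j', hj'⟩ => hcon _ ⟨m, n, k, l, h0, rfl⟩
          ⟨j, sub_eq_iff_eq_add.1 hj⟩ j' (sub_eq_iff_eq_add.1 hj')) _ _ hα.le hβ.le]
      refine Finset.sum_congr rfl fun t' _ => ?_
      rw [← hexp _ (mem_closedBall_zero_iff.2 (by rw [norm_mul, hω1, hα, one_mul])) _
        (mem_closedBall_zero_iff.2 (by rw [norm_mul, hτ1, hβ, one_mul]))]
      simp only [hdot_smul_left, hdot_smul_right, hdot_self_of_norm_one _ hn, mul_one, mul_comm]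
  have := congrFun hc (⟨0, by omega⟩, ⟨0, by omega⟩)
  simp at this

/-- Theorem 1.1 / `th_main`: for `q, p ∈ ℕ ∪ {∞}` with `q, p ≥ 2`,
a continuous PD function on `Ω_{2q} × Ω_{2p}` is SPD if and only if the set
`J' = {(m-n, k-l) : a_{m,n,k,l} > 0}` from its disc-polynomial expansion intersects
every product of full arithmetic progressions in ℤ. -/
theorem stmt0 (q p : ℕ∞) (hq : 2 ≤ q) (hp : 2 ≤ p) (f : ℂ → ℂ → ℂ)
    (hf : ContinuousOn (fun v : ℂ × ℂ => f v.1 v.2)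
      (Metric.closedBall 0 1 ×ˢ Metric.closedBall 0 1))
    (hPD : PDonProd q p f)
    (a : ℕ × ℕ × ℕ × ℕ → ℝ) (ha0 : ∀ i, 0 ≤ a i) (haS : Summable a)
    (hexp : ∀ ξ ∈ Metric.closedBall (0 : ℂ) 1, ∀ η ∈ Metric.closedBall (0 : ℂ) 1,
      f ξ η = ∑' i : ℕ × ℕ × ℕ × ℕ,
        (a i : ℂ) * discR q i.1 i.2.1 ξ * discR p i.2.2.1 i.2.2.2 η) :
    SPDonProd q p f ↔
      MeetsAllProgressions
        {v : ℤ × ℤ | ∃ m n k l : ℕ, 0 < a (m, n, k, l) ∧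
          v = ((m : ℤ) - (n : ℤ), (k : ℤ) - (l : ℤ))} := by
  refine ⟨SPDonProd.meetsAllProgressions hq hp ha0 haS hexp, fun hJ => ⟨hPD, ?_⟩⟩
  intro L x hx hinj c h0
  have hmem : ∀ μ ν, ‖hdot (x μ).1 (x ν).1‖ ≤ 1 ∧ ‖hdot (x μ).2 (x ν).2‖ ≤ 1 := fun μ ν =>
    ⟨norm_hdot_le_one _ _ (hx μ).1.1 (hx ν).1.1, norm_hdot_le_one _ _ (hx μ).2.1 (hx ν).2.1⟩
  refine eq_zero_of_forall_sum_mul_discSeries_coeffPart q p ha0 haS hJ (fun μ => (x μ).1)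
    (fun μ => (x μ).2) (fun μ => (hx μ).1.1) (fun μ => (hx μ).2.1)
    (fun i j h1 h2 => hinj (Prod.ext h1 h2)) c fun d e ν => ?_
  refine sum_mul_discSeries_coeffPart_eq_zero q p ha0 haS c _ _ (fun μ => (hmem μ ν).1)
    (fun μ => (hmem μ ν).2) (fun u v hu hv => ?_) d e
  have h1 := hPD.sum_eq_zero L x hx hinj c h0
    ((starRingEnd ℂ) u • (x ν).1, (starRingEnd ℂ) v • (x ν).2)
    ⟨smul_mem_Omega q _ (by rw [RCLike.norm_conj, hu]) _ (hx ν).1,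
      smul_mem_Omega p _ (by rw [RCLike.norm_conj, hv]) _ (hx ν).2⟩
  simp only [hdot_smul_right, Complex.conj_conj] at h1
  rw [← h1]
  refine Finset.sum_congr rfl fun μ _ => ?_
  rw [hexp _ (mem_closedBall_zero_iff.2 (by rw [norm_mul, hu, one_mul]; exact (hmem μ ν).1)) _
    (mem_closedBall_zero_iff.2 (by rw [norm_mul, hv, one_mul]; exact (hmem μ ν).2)), discSeries]

end
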